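/- If m_A ≠ m_C and m_B ≠ m_D, then the center map Ψ : Π → ℝ³ is an invertible linear transformation (a linear isomorphism of Π onto ℝ³); in particular every conformally inscribed parallelogram is uniquely determined by its center and its scale. -/

import Mathlib

noncomputable section

open Real Set

/-- Membership predicate for conformally inscribed parallelograms.
Coordinates of `P : Fin 9 → ℝ`:
`0 = x_A, 1 = y_A, 2 = x_B, 3 = y_B, 4 = x_C, 5 = y_C, 6 = x_D, 7 = y_D, 8 = w`.
The vertex `(x_L, y_L)` lies on the line `L(w)` for `L ∈ {A,B,C,D}` and the
midpoints of the two diagonals coincide. -/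
def IsCIP (mA mB mC mD bA : ℝ) (P : Fin 9 → ℝ) : Prop :=
  P 1 = mA * P 0 + bA * P 8 ∧
  P 3 = mB * P 2 + P 8 ∧
  P 5 = mC * P 4 ∧
  P 7 = mD * P 6 ∧
  P 0 + P 4 = P 2 + P 6 ∧
  P 1 + P 5 = P 3 + P 7

/-- `Π`, the set of conformally inscribed parallelograms. -/
def CIP (mA mB mC mD bA : ℝ) : Set (Fin 9 → ℝ) := {P | IsCIP mA mB mC mD bA P}

/-- The `AC` diagonal vector of a parallelogram. -/
def vAC (P : Fin 9 → ℝ) : ℝ × ℝ := (P 0 - P 4, P 1 - P 5)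

/-- The `BD` diagonal vector of a parallelogram. -/
def vBD (P : Fin 9 → ℝ) : ℝ × ℝ := (P 2 - P 6, P 3 - P 7)

/-- The `AB` side vector of a parallelogram. -/
def vAB (P : Fin 9 → ℝ) : ℝ × ℝ := (P 0 - P 2, P 1 - P 3)

/-- The `BC` side vector of a parallelogram. -/
def vBC (P : Fin 9 → ℝ) : ℝ × ℝ := (P 2 - P 4, P 3 - P 5)

/-- Dot product in `ℝ²`. -/
def dot2 (a b : ℝ × ℝ) : ℝ := a.1 * b.1 + a.2 * b.2

/-- The inner product `⟨P, Q⟩ = P_AC · Q_AC + P_BD · Q_BD` on `Π`. -/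
def pinner (P Q : Fin 9 → ℝ) : ℝ := dot2 (vAC P) (vAC Q) + dot2 (vBD P) (vBD Q)

/-- The center map `Ψ : Π → ℝ³`, sending `P` to its center together with its scale. -/
def centerMap (P : Fin 9 → ℝ) : ℝ × ℝ × ℝ := ((P 0 + P 4) / 2, (P 1 + P 5) / 2, P 8)

/-- A point is the midpoint of a unique pair of points on two lines with distinct slopes:
the corresponding linear system in the abscissas of the two points, in solved form. -/
lemma add_eq_and_mul_add_mul_eq_iff {m n : ℝ} (h : m ≠ n) (u v s t : ℝ) :
    (u + v = s ∧ m * u + n * v = t) ↔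
      (u = (t - n * s) / (m - n) ∧ v = (m * s - t) / (m - n)) := by
  have hmn : m - n ≠ 0 := sub_ne_zero.mpr h
  constructor
  · rintro ⟨rfl, rfl⟩
    constructor <;> field_simp <;> ring
  · rintro ⟨rfl, rfl⟩
    constructor <;> field_simp <;> ring

lemma centerMap_smul_add (c : ℝ) (P Q : Fin 9 → ℝ) :
    centerMap (c • P + Q) = c • centerMap P + centerMap Q := by
  simp only [centerMap, Pi.add_apply, Pi.smul_apply, smul_eq_mul, Prod.smul_mk, Prod.mk_add_mk,
    Prod.mk.injEq]
  exact ⟨by ring, by ring, trivial⟩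

/-- The parallelogram with vertices of abscissas `a, b, c, d` on the lines at scale `w`. -/
def parallelogramOfAbscissas (mA mB mC mD bA a b c d w : ℝ) : Fin 9 → ℝ :=
  ![a, mA * a + bA * w, b, mB * b + w, c, mC * c, d, mD * d, w]

/-- A tuple is an inscribed parallelogram with center `(x, y)` and scale `w` exactly when it is the
one given by solving for the endpoints of its two diagonals. -/
lemma isCIP_and_centerMap_eq_iff {mA mB mC mD : ℝ} (bA : ℝ) (hAC : mA ≠ mC) (hBD : mB ≠ mD)
    (P : Fin 9 → ℝ) (x y w : ℝ) :
    (IsCIP mA mB mC mD bA P ∧ centerMap P = (x, y, w)) ↔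
      P = parallelogramOfAbscissas mA mB mC mD bA
        ((2 * y - bA * w - mC * (2 * x)) / (mA - mC)) ((2 * y - w - mD * (2 * x)) / (mB - mD))
        ((mA * (2 * x) - (2 * y - bA * w)) / (mA - mC))
        ((mB * (2 * x) - (2 * y - w)) / (mB - mD)) w := by
  have solveAC := add_eq_and_mul_add_mul_eq_iff hAC (s := 2 * x) (t := 2 * y - bA * w)
  have solveBD := add_eq_and_mul_add_mul_eq_iff hBD (s := 2 * x) (t := 2 * y - w)
  constructor
  · rintro ⟨⟨hA, hB, hC, hD, hx, hy⟩, hcenter⟩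
    simp only [centerMap, Prod.mk.injEq] at hcenter
    obtain ⟨cx, cy, rfl⟩ := hcenter
    obtain ⟨h0, h4⟩ := (solveAC (P 0) (P 4)).mp ⟨by linarith, by linarith⟩
    obtain ⟨h2, h6⟩ := (solveBD (P 2) (P 6)).mp ⟨by linarith, by linarith⟩
    rw [← h0, ← h2, ← h4, ← h6]
    ext i
    fin_cases i <;> first | rfl | assumption
  · rintro rfl
    obtain ⟨sumAC, slopeAC⟩ := (solveAC _ _).mpr ⟨rfl, rfl⟩
    obtain ⟨sumBD, slopeBD⟩ := (solveBD _ _).mpr ⟨rfl, rfl⟩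
    refine ⟨⟨rfl, rfl, rfl, rfl, sumAC.trans sumBD.symm, ?_⟩, ?_⟩
    · change mA * _ + bA * w + mC * _ = mB * _ + w + mD * _
      linarith
    · refine Prod.ext ((div_eq_iff two_ne_zero).mpr (sumAC.trans (mul_comm 2 x)))
        (Prod.ext ?_ rfl)
      change (mA * _ + bA * w + mC * _) / 2 = y
      linarith

theorem stmt_15 (mA mB mC mD bA : ℝ) (hCD : mC ≠ mD)
    (hAC : mA ≠ mC) (hBD : mB ≠ mD) :
    (∀ (c : ℝ) (P Q : Fin 9 → ℝ),
        centerMap (c • P + Q) = c • centerMap P + centerMap Q) ∧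
    Function.Bijective
      (fun P : CIP mA mB mC mD bA => centerMap (P : Fin 9 → ℝ)) := by
  refine ⟨centerMap_smul_add, Function.bijective_iff_existsUnique _ |>.mpr ?_⟩
  rintro ⟨x, y, w⟩
  have key := isCIP_and_centerMap_eq_iff bA hAC hBD (x := x) (y := y) (w := w)
  obtain ⟨hP, hcenter⟩ := (key _).mpr rfl
  exact ⟨⟨_, hP⟩, hcenter, fun Q hQ => Subtype.ext ((key Q).mp ⟨Q.2, hQ⟩)⟩
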